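/- arXiv:2603.20710 — 5 statements merged into one kernel-verified Lean document; each statement's English description precedes it below -/
import Mathlib

section
/- Representation of heat solutions on the observation set: let T ≥ 1, B ⊆ X, and let f : ℕ × X → ℝ be supported on Z_T × B. Then for every x ∈ B: U^f(0,x) = 0; U^f(1,x) = f(0,x); and for every t with 2 ≤ t ≤ 2T−1, U^f(t,x) = Σ_{y∈B} f(t−2,y) r(1,x,y) + Σ_{s=1}^{t−2} Σ_{y∈B} f(s−1,y) [ r(t−s,x,y) + Σ_{j=2}^{t−s} Σ_{1 ≤ t_1 < ⋯ < t_j = t−s} r(t_1,x,y) Π_{i=2}^{j} r(t_i − t_{i−1}, y, y) ] + f(t−1,x). -/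
open Finset

/-- The graph Laplacian: `Δu(x) = (1/μ(x)) · Σ_{y∈X} w(x,y)(u(y) − u(x))`. -/
noncomputable def graphLap {X : Type*} [Fintype X] (w : X → X → ℝ) (μ : X → ℝ)
    (u : X → ℝ) (x : X) : ℝ :=
  (1 / μ x) * ∑ y, w x y * (u y - u x)

/-- The transition probabilities: `p(x,y) = w(x,y)/μ(x)` for `y ≠ x` and
`p(x,x) = 1 − (1/μ(x)) Σ_{y≠x} w(x,y)`. -/
noncomputable def transProb {X : Type*} [Fintype X] [DecidableEq X]
    (w : X → X → ℝ) (μ : X → ℝ) (x y : X) : ℝ :=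
  if y = x then 1 - (1 / μ x) * ∑ z ∈ Finset.univ.erase x, w x z
  else w x y / μ x

/-- The distribution of first passage times: `r(1,x,y) = p(x,y)` and
`r(t+1,x,y) = Σ_{z≠y} p(x,z) r(t,z,y)` for `t ≥ 1`.  (The value at `t = 0` is unused.) -/
noncomputable def fpt {X : Type*} [Fintype X] [DecidableEq X]
    (p : X → X → ℝ) : ℕ → X → X → ℝ
  | 0 => fun _ _ => 0
  | 1 => fun x y => p x y
  | t + 2 => fun x y => ∑ z ∈ Finset.univ.erase y, p x z * fpt p (t + 1) z y

/-- The solution of the nonhomogeneous graph heat equation with zero initial data: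
`U^f(0,x) = 0` and `U^f(t+1,x) = U^f(t,x) + ΔU^f(t,x) + f(t,x)`. -/
noncomputable def heatSol {X : Type*} [Fintype X] (w : X → X → ℝ) (μ : X → ℝ)
    (f : ℕ → X → ℝ) : ℕ → X → ℝ
  | 0 => fun _ => 0
  | t + 1 => fun x => heatSol w μ f t x + graphLap w μ (heatSol w μ f t) x + f t x

/-- `f : ℕ × X → ℝ` is supported on `Z_T × B`: `f(t,x) = 0` whenever `t ≥ T` or `x ∉ B`. -/
def SuppOn {X : Type*} (T : ℕ) (B : Finset X) (f : ℕ → X → ℝ) : Prop :=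
  ∀ t x, (T ≤ t ∨ x ∉ B) → f t x = 0

/-- `retProd ryy prev [a₁, …, aₖ]` is `ryy (a₁ − prev) · ryy (a₂ − a₁) ⋯ ryy (aₖ − aₖ₋₁)`. -/
def retProd (ryy : ℕ → ℝ) : ℕ → List ℕ → ℝ
  | _, [] => 1
  | prev, a :: l => ryy (a - prev) * retProd ryy a l

/-- For a finite set `S = {t₁ < t₂ < ⋯ < t_j}` of positive integers, `seqTerm rxy ryy S`
is the term `rxy t₁ · Π_{i=2}^{j} ryy (tᵢ − tᵢ₋₁)`. -/
def seqTerm (rxy ryy : ℕ → ℝ) (S : Finset ℕ) : ℝ :=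
  match S.sort (· ≤ ·) with
  | [] => 0
  | t1 :: rest => rxy t1 * retProd ryy t1 rest

section Renewal

/-- The defining recursion of `fpt`, completed by the missing term `z = y`. -/
lemma sum_mul_fpt {X : Type*} [Fintype X] [DecidableEq X] (p : X → X → ℝ) (k : ℕ) (x y : X) :
    ∑ z, p x z * fpt p (k + 1) z y = fpt p (k + 2) x y + p x y * fpt p (k + 1) y y := by
  rw [← Finset.sum_erase_add _ _ (Finset.mem_univ y)]
  rfl

/-- First-passage decomposition of the powers of a transition matrix. -/
lemma pow_succ_apply_eq_sum_fpt {X : Type*} [Fintype X] [DecidableEq X] (p : X → X → ℝ) (y : X)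
    (n : ℕ) (x : X) :
    (Matrix.of p ^ (n + 1)) x y =
      ∑ k ∈ Finset.range (n + 1), fpt p (k + 1) x y * (Matrix.of p ^ (n - k)) y y := by
  induction n generalizing x with
  | zero => simp [fpt]
  | succ n ih =>
    rw [pow_succ', Matrix.mul_apply, Finset.sum_range_succ']
    simp only [Matrix.of_apply, ih, Finset.mul_sum]
    rw [Finset.sum_comm]
    simp only [← mul_assoc, ← Finset.sum_mul, sum_mul_fpt, add_mul, Finset.sum_add_distrib]
    congr 1
    · refine Finset.sum_congr rfl fun k _ => ?_
      rw [Nat.add_sub_add_right]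
    · simp only [mul_assoc, ← Finset.mul_sum]
      rw [← ih y]
      rfl

end Renewal

section Sequences

lemma seqTerm_singleton (g ρ : ℕ → ℝ) (n : ℕ) : seqTerm g ρ {n} = g n := by
  simp [seqTerm, retProd]

lemma seqTerm_insert_of_lt (g ρ : ℕ → ℝ) {a : ℕ} {S : Finset ℕ} (hS : S.Nonempty)
    (ha : ∀ b ∈ S, a < b) :
    seqTerm g ρ (insert a S) = g a * seqTerm (fun m => ρ (m - a)) ρ S := by
  have hmem : a ∉ S := fun h => lt_irrefl a (ha a h)
  unfold seqTerm
  rw [Finset.sort_insert (r := (· ≤ ·)) (fun b hb => (ha b hb).le) hmem]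
  cases h : S.sort (· ≤ ·) with
  | nil =>
    have := congrArg List.length h
    simp [hS.ne_empty] at this
  | cons b l => rfl

/-- If `q` solves the renewal equation with return weights `ρ`, the sum of `seqTerm g ρ` over
all increasing sequences in `(a, n]` ending at `n` is a convolution of `g` with `q`. -/
lemma sum_seqTerm_eq_sum_mul (ρ q : ℕ → ℝ) (hq0 : q 0 = 1)
    (hq : ∀ n, q (n + 1) = ∑ k ∈ Finset.range (n + 1), ρ (k + 1) * q (n - k)) (n d : ℕ)
    (g : ℕ → ℝ) (a : ℕ) (had : a + d = n) :
    ∑ S ∈ (Finset.Ioc a n).powerset with n ∈ S, seqTerm g ρ S =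
      ∑ k ∈ Finset.range d, g (a + k + 1) * q (n - (a + k + 1)) := by
  induction d generalizing g a with
  | zero =>
    subst had
    simp [Finset.sum_filter]
  | succ d ih =>
    have hI : Finset.Ioc a n = insert (a + 1) (Finset.Ioc (a + 1) n) := by
      ext m; simp only [Finset.mem_Ioc, Finset.mem_insert]; omega
    rw [hI, Finset.sum_filter, Finset.sum_powerset_insert (by simp), ← Finset.sum_filter,
      ih g (a + 1) (by omega), Finset.sum_range_succ']
    congr 1
    · refine Finset.sum_congr rfl fun k _ => ?_
      rw [show a + 1 + k + 1 = a + (k + 1) + 1 by omega]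
    · rcases d with _ | d
      · subst had
        simp [seqTerm_singleton, hq0]
      · have hlt : a + 1 ≠ n := by omega
        rw [← Finset.sum_filter,
          Finset.filter_congr (q := fun S => n ∈ S) (by simp [Finset.mem_insert, hlt.symm]),
          Finset.sum_congr rfl fun S hS => seqTerm_insert_of_lt g ρ
            ⟨n, (Finset.mem_filter.1 hS).2⟩ fun b hb => (Finset.mem_Ioc.1
              (Finset.mem_powerset.1 (Finset.mem_filter.1 hS).1 hb)).1,
          ← Finset.mul_sum, ih _ (a + 1) (by omega),
          show n - (a + 0 + 1) = d + 1 by omega, hq]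
        congr 1
        refine Finset.sum_congr rfl fun k _ => ?_
        rw [show a + 1 + k + 1 - (a + 1) = k + 1 by omega,
          show n - (a + 1 + k + 1) = d - k by omega]

/-- Splitting the sequences ending at `n` according to their length. -/
lemma sum_seqTerm_eq_add_sum_card (g ρ : ℕ → ℝ) {n : ℕ} (hn : 1 ≤ n) :
    ∑ S ∈ (Finset.Icc 1 n).powerset with n ∈ S, seqTerm g ρ S =
      g n + ∑ j ∈ Finset.Icc 2 n,
        ∑ S ∈ (Finset.Icc 1 n).powerset.filter (fun S => n ∈ S ∧ S.card = j),
          seqTerm g ρ S := by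
  rw [← Finset.sum_fiberwise_of_maps_to (t := Finset.Icc 1 n) (g := Finset.card)]
  · have hI : Finset.Icc 1 n = insert 1 (Finset.Icc 2 n) := by
      ext m; simp only [Finset.mem_Icc, Finset.mem_insert]; omega
    conv_lhs => rw [show ∀ F : ℕ → ℝ, ∑ j ∈ Finset.Icc 1 n, F j = F 1 + ∑ j ∈ Finset.Icc 2 n, F j
      from fun F => by rw [hI, Finset.sum_insert (by simp)]]
    simp only [Finset.filter_filter]
    congr 1
    have : (Finset.Icc 1 n).powerset.filter (fun S => n ∈ S ∧ S.card = 1) = {{n}} := by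
      ext S
      simp only [Finset.mem_filter, Finset.mem_powerset, Finset.mem_singleton]
      constructor
      · rintro ⟨-, hnS, hc⟩
        obtain ⟨b, rfl⟩ := Finset.card_eq_one.1 hc
        rw [Finset.mem_singleton.1 hnS]
      · rintro rfl
        simp [hn]
    rw [this, Finset.sum_singleton, seqTerm_singleton]
  · intro S hS
    obtain ⟨hS, hnS⟩ := Finset.mem_filter.1 hS
    refine Finset.mem_Icc.2 ⟨Finset.card_pos.2 ⟨n, hnS⟩, ?_⟩
    simpa using Finset.card_le_card (Finset.mem_powerset.1 hS)

/-- The powers of a transition matrix, expanded along the successive visits to `y`. -/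
lemma pow_apply_eq_fpt_add_sum_seqTerm {X : Type*} [Fintype X] [DecidableEq X] (p : X → X → ℝ)
    (x y : X) {n : ℕ} (hn : 1 ≤ n) :
    (Matrix.of p ^ n) x y = fpt p n x y + ∑ j ∈ Finset.Icc 2 n,
      ∑ S ∈ (Finset.Icc 1 n).powerset.filter (fun S => n ∈ S ∧ S.card = j),
        seqTerm (fun u => fpt p u x y) (fun u => fpt p u y y) S := by
  obtain ⟨n, rfl⟩ := Nat.exists_eq_add_of_le' hn
  rw [← sum_seqTerm_eq_add_sum_card (fun u => fpt p u x y) (fun u => fpt p u y y) hn,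
    show Finset.Icc 1 (n + 1) = Finset.Ioc 0 (n + 1) from rfl,
    sum_seqTerm_eq_sum_mul (fun u => fpt p u y y) (fun k => (Matrix.of p ^ k) y y) (by simp)
      (fun n => pow_succ_apply_eq_sum_fpt p y n y) (n + 1) (n + 1) _ 0 (by omega),
    pow_succ_apply_eq_sum_fpt]
  simp

end Sequences

section Duhamel

lemma add_graphLap {X : Type*} [Fintype X] [DecidableEq X] (w : X → X → ℝ) (μ : X → ℝ)
    (u : X → ℝ) (x : X) : u x + graphLap w μ u x = ∑ y, transProb w μ x y * u y := by
  have h : ∀ y ∈ Finset.univ.erase x, transProb w μ x y * u y = 1 / μ x * (w x y * u y) :=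
    fun y hy => by rw [transProb, if_neg (Finset.ne_of_mem_erase hy)]; ring
  rw [graphLap, ← Finset.sum_erase_add _ _ (Finset.mem_univ x),
    ← Finset.sum_erase_add _ (fun y => transProb w μ x y * u y) (Finset.mem_univ x),
    Finset.sum_congr rfl h, ← Finset.mul_sum, transProb, if_pos rfl]
  simp only [mul_sub, Finset.sum_sub_distrib, ← Finset.sum_mul]
  ring

/-- Duhamel's formula for the nonhomogeneous graph heat equation. -/
lemma heatSol_eq_sum_pow {X : Type*} [Fintype X] [DecidableEq X] (w : X → X → ℝ) (μ : X → ℝ)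
    (f : ℕ → X → ℝ) (t : ℕ) (x : X) :
    heatSol w μ f t x =
      ∑ s ∈ Finset.range t, ∑ y, f s y * (Matrix.of (transProb w μ) ^ (t - 1 - s)) x y := by
  induction t generalizing x with
  | zero => rfl
  | succ t ih =>
    simp only [heatSol, add_graphLap]
    rw [Finset.sum_range_succ]
    congr 1
    · simp only [ih, Finset.mul_sum]
      rw [Finset.sum_comm]
      refine Finset.sum_congr rfl fun s hs => ?_
      rw [Finset.sum_comm]
      refine Finset.sum_congr rfl fun y _ => ?_
      rw [show t + 1 - 1 - s = (t - 1 - s) + 1 by have := Finset.mem_range.1 hs; omega, pow_succ',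
        Matrix.mul_apply, Finset.mul_sum]
      refine Finset.sum_congr rfl fun z _ => ?_
      rw [Matrix.of_apply]
      ring
    · simp [Matrix.one_apply]

end Duhamel

/-- Representation of heat solutions on the observation set `B` in terms of the source `f`
and the first passage time distributions `r`. -/
theorem heat_solution_representation_on_B {X : Type*} [Fintype X] [DecidableEq X] [Nonempty X]
    (w : X → X → ℝ) (μ : X → ℝ)
    (hw_symm : ∀ x y, w x y = w y x)
    (hw_nonneg : ∀ x y, 0 ≤ w x y)
    (hw_diag : ∀ x, w x x = 0)
    (hμ : ∀ x, 0 < μ x)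
    (T : ℕ) (hT : 1 ≤ T) (B : Finset X)
    (f : ℕ → X → ℝ) (hf : SuppOn T B f)
    (x : X) (hx : x ∈ B) :
    heatSol w μ f 0 x = 0 ∧
    heatSol w μ f 1 x = f 0 x ∧
    ∀ t : ℕ, 2 ≤ t → t ≤ 2 * T - 1 →
      heatSol w μ f t x =
        (∑ y ∈ B, f (t - 2) y * fpt (transProb w μ) 1 x y) +
        (∑ s ∈ Finset.Icc 1 (t - 2), ∑ y ∈ B,
          f (s - 1) y *
            (fpt (transProb w μ) (t - s) x y +
              ∑ j ∈ Finset.Icc 2 (t - s),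
                ∑ S ∈ (Finset.Icc 1 (t - s)).powerset.filter
                    (fun S => (t - s) ∈ S ∧ S.card = j),
                  seqTerm (fun u => fpt (transProb w μ) u x y)
                    (fun u => fpt (transProb w μ) u y y) S)) +
        f (t - 1) x := by
  have hB : ∀ (s n : ℕ), ∑ y, f s y * (Matrix.of (transProb w μ) ^ n) x y =
      ∑ y ∈ B, f s y * (Matrix.of (transProb w μ) ^ n) x y := fun s n =>
    (Finset.sum_subset (Finset.subset_univ B) fun y _ hy => by
      rw [hf s y (Or.inr hy), zero_mul]).symm
  refine ⟨rfl, by simp [heatSol, graphLap], fun t ht _ => ?_⟩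
  obtain ⟨n, rfl⟩ := Nat.exists_eq_add_of_le' ht
  rw [heatSol_eq_sum_pow, Finset.sum_range_succ, Finset.sum_range_succ,
    add_comm (∑ s ∈ Finset.range n, _)]
  congr 1
  · congr 1
    · rw [hB, show n + 2 - 1 - n = 1 by omega, pow_one]
      rfl
    · rw [Nat.add_sub_cancel, ← Finset.Ico_add_one_right_eq_Icc, Finset.sum_Ico_eq_sum_range,
        Nat.add_sub_cancel]
      refine Finset.sum_congr rfl fun s hs => ?_
      have := Finset.mem_range.1 hs
      rw [hB, show n + 2 - 1 - s = n + 2 - (1 + s) by omega, Nat.add_sub_cancel_left]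
      refine Finset.sum_congr rfl fun y _ => ?_
      rw [pow_apply_eq_fpt_add_sum_seqTerm _ _ _ (by omega)]
  · simp [Matrix.one_apply]
end

section
/- Blagovescenskii-type identity: let T ≥ 1, B ⊆ X, and let f₁, f₂ : ℕ × X → ℝ be supported on Z_T × B. Then ⟨U^{f₁}(T,·), U^{f₂}(T,·)⟩_X = Σ_{j=0}^{T−1} Σ_{x∈B} μ(x) f₁(j,x) U^{f₂}(2T−1−j, x). -/
open Finset

/-- The graph Laplacian is symmetric for the inner product weighted by `μ`. -/
theorem sum_mul_graphLap_comm {X : Type*} [Fintype X] {w : X → X → ℝ} {μ : X → ℝ}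
    (hw_symm : ∀ x y, w x y = w y x) (hμ : ∀ x, μ x ≠ 0) (u v : X → ℝ) :
    ∑ x, μ x * graphLap w μ u x * v x = ∑ x, μ x * u x * graphLap w μ v x := by
  have hl (a : X → ℝ) (x : X) : μ x * graphLap w μ a x = ∑ y, w x y * (a y - a x) := by
    rw [graphLap, ← mul_assoc, mul_one_div_cancel (hμ x), one_mul]
  have hswap : ∑ x, ∑ y, w x y * u y * v x = ∑ x, ∑ y, w x y * u x * v y := by
    rw [Finset.sum_comm]
    simp only [hw_symm]
  calc ∑ x, μ x * graphLap w μ u x * v x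
      = ∑ x, ∑ y, w x y * u y * v x - ∑ x, ∑ y, w x y * u x * v x := by
        simp only [hl, Finset.sum_mul, ← Finset.sum_sub_distrib]
        simp only [mul_sub, sub_mul]
    _ = ∑ x, ∑ y, w x y * u x * v y - ∑ x, ∑ y, w x y * u x * v x := by rw [hswap]
    _ = ∑ x, μ x * u x * graphLap w μ v x := by
        rw [← Finset.sum_sub_distrib]
        refine Finset.sum_congr rfl fun x _ => ?_
        rw [mul_right_comm, hl, Finset.sum_mul, ← Finset.sum_sub_distrib]
        exact Finset.sum_congr rfl fun y _ => by ring

/-- Pairing two heat solutions at consecutive times, when the second source vanishes. -/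
theorem sum_mul_heatSol_succ {X : Type*} [Fintype X] {w : X → X → ℝ} {μ : X → ℝ}
    (hw_symm : ∀ x y, w x y = w y x) (hμ : ∀ x, μ x ≠ 0) (f g : ℕ → X → ℝ) (t s : ℕ)
    (hg : ∀ x, g s x = 0) :
    ∑ x, μ x * heatSol w μ f (t + 1) x * heatSol w μ g s x =
      ∑ x, μ x * heatSol w μ f t x * heatSol w μ g (s + 1) x +
        ∑ x, μ x * f t x * heatSol w μ g s x := by
  simp only [heatSol, hg, add_zero, mul_add, add_mul, Finset.sum_add_distrib,
    sum_mul_graphLap_comm hw_symm hμ]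

/-- Blagovescenskii-type identity:
`⟨U^{f₁}(T,·), U^{f₂}(T,·)⟩_X = Σ_{j=0}^{T−1} Σ_{x∈B} μ(x) f₁(j,x) U^{f₂}(2T−1−j, x)`. -/
theorem blagovescenskii_identity {X : Type*} [Fintype X] [Nonempty X]
    (w : X → X → ℝ) (μ : X → ℝ)
    (hw_symm : ∀ x y, w x y = w y x)
    (hw_nonneg : ∀ x y, 0 ≤ w x y)
    (hw_diag : ∀ x, w x x = 0)
    (hμ : ∀ x, 0 < μ x)
    (T : ℕ) (hT : 1 ≤ T) (B : Finset X)
    (f₁ f₂ : ℕ → X → ℝ) (hf₁ : SuppOn T B f₁) (hf₂ : SuppOn T B f₂) :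
    ∑ x, μ x * heatSol w μ f₁ T x * heatSol w μ f₂ T x =
      ∑ j ∈ Finset.range T, ∑ x ∈ B, μ x * f₁ j x * heatSol w μ f₂ (2 * T - 1 - j) x := by
  have hμ' x : μ x ≠ 0 := (hμ x).ne'
  have key : ∀ t ≤ T, ∑ x, μ x * heatSol w μ f₁ t x * heatSol w μ f₂ (2 * T - t) x =
      ∑ j ∈ Finset.range t, ∑ x, μ x * f₁ j x * heatSol w μ f₂ (2 * T - 1 - j) x := by
    intro t
    induction t with
    | zero => simp [heatSol]
    | succ t ih =>
      intro ht
      rw [Finset.sum_range_succ, ← ih (by omega),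
        sum_mul_heatSol_succ hw_symm hμ' _ _ _ _ fun x => hf₂ _ x (Or.inl (by omega)),
        show 2 * T - (t + 1) + 1 = 2 * T - t by omega,
        show 2 * T - (t + 1) = 2 * T - 1 - t by omega]
  have h := key T le_rfl
  rw [show 2 * T - T = T by omega] at h
  rw [h]
  refine Finset.sum_congr rfl fun j _ =>
    (Finset.sum_subset (Finset.subset_univ B) fun x _ hx => ?_).symm
  rw [hf₁ j x (Or.inr hx), mul_zero, zero_mul]
end

section
/- Pairing with harmonic functions: let T ≥ 1, B ⊆ X, let φ : X → ℝ be harmonic on X \ B, and let f : ℕ × X → ℝ be supported on Z_T × B. Then ⟨U^f(T,·), φ⟩_X = Σ_{j=0}^{T−1} [ ⟨U^f(j,·), Δφ⟩_B + ⟨f(j,·), φ⟩_B ]. -/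
open Finset

/-- The graph Laplacian is symmetric for the weighted inner product. -/
theorem sum_graphLap_mul_comm {X : Type*} [Fintype X] (w : X → X → ℝ) (μ : X → ℝ)
    (hw_symm : ∀ x y, w x y = w y x) (hμ : ∀ x, μ x ≠ 0) (u v : X → ℝ) :
    ∑ x, μ x * graphLap w μ u x * v x = ∑ x, μ x * u x * graphLap w μ v x := by
  have hleft : ∀ x, μ x * graphLap w μ u x * v x =
      ∑ y, w x y * u y * v x - ∑ y, w x y * u x * v x := by
    intro x
    rw [graphLap, ← mul_assoc, mul_one_div_cancel (hμ x), one_mul, Finset.sum_mul,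
      ← Finset.sum_sub_distrib]
    exact Finset.sum_congr rfl fun y _ => by ring
  have hright : ∀ x, μ x * u x * graphLap w μ v x =
      ∑ y, w x y * u x * v y - ∑ y, w x y * u x * v x := by
    intro x
    rw [graphLap, mul_right_comm, ← mul_assoc, mul_one_div_cancel (hμ x), one_mul,
      Finset.sum_mul, ← Finset.sum_sub_distrib]
    exact Finset.sum_congr rfl fun y _ => by ring
  simp only [hleft, hright, Finset.sum_sub_distrib]
  congr 1
  rw [Finset.sum_comm]
  exact Finset.sum_congr rfl fun x _ => Finset.sum_congr rfl fun y _ => by rw [hw_symm]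

/-- Pairing with harmonic functions: if `φ` is harmonic on `X \ B` then
`⟨U^f(T,·), φ⟩_X = Σ_{j=0}^{T−1} [⟨U^f(j,·), Δφ⟩_B + ⟨f(j,·), φ⟩_B]`. -/
theorem pairing_with_harmonic {X : Type*} [Fintype X] [Nonempty X]
    (w : X → X → ℝ) (μ : X → ℝ)
    (hw_symm : ∀ x y, w x y = w y x)
    (hw_nonneg : ∀ x y, 0 ≤ w x y)
    (hw_diag : ∀ x, w x x = 0)
    (hμ : ∀ x, 0 < μ x)
    (T : ℕ) (hT : 1 ≤ T) (B : Finset X)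
    (φ : X → ℝ) (hφ : ∀ x, x ∉ B → graphLap w μ φ x = 0)
    (f : ℕ → X → ℝ) (hf : SuppOn T B f) :
    ∑ x, μ x * heatSol w μ f T x * φ x =
      ∑ j ∈ Finset.range T,
        ((∑ x ∈ B, μ x * heatSol w μ f j x * graphLap w μ φ x) +
          (∑ x ∈ B, μ x * f j x * φ x)) := by
  have hstep : ∀ t, ∑ x, μ x * heatSol w μ f (t + 1) x * φ x =
      ∑ x, μ x * heatSol w μ f t x * φ x +
        ((∑ x ∈ B, μ x * heatSol w μ f t x * graphLap w μ φ x) +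
          ∑ x ∈ B, μ x * f t x * φ x) := by
    intro t
    rw [Finset.sum_subset (f := fun x => μ x * heatSol w μ f t x * graphLap w μ φ x)
        (Finset.subset_univ B) fun x _ hx => by simp [hφ x hx],
      Finset.sum_subset (f := fun x => μ x * f t x * φ x)
        (Finset.subset_univ B) fun x _ hx => by simp [hf t x (Or.inr hx)],
      ← sum_graphLap_mul_comm w μ hw_symm (fun x => (hμ x).ne'), ← Finset.sum_add_distrib,
      ← Finset.sum_add_distrib]
    exact Finset.sum_congr rfl fun x _ => by rw [heatSol]; ring
  clear hT hf
  induction T with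
  | zero => simp [heatSol]
  | succ t ih => rw [hstep, ih, Finset.sum_range_succ]
end

section
/- Exact controllability of the graph heat equation: suppose the graph is connected, μ(x) ≥ Σ_{y∈X} w(x,y) for every x ∈ X, and there is no nonzero eigenfunction of −Δ vanishing on B (i.e., if v : X → ℝ and λ ∈ ℝ satisfy −Δv(x) = λ v(x) for all x ∈ X and v(b) = 0 for all b ∈ B, then v = 0). If T ≥ |X|, then for every g : X → ℝ there exists f : ℕ × X → ℝ supported on Z_T × B such that U^f(T, x) = g(x) for all x ∈ X. -/
open Finset

/-- The graph with edge weight `w` is connected. -/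
def GraphConn {X : Type*} (w : X → X → ℝ) : Prop :=
  ∀ x y : X, ∃ (k : ℕ) (z : ℕ → X), z 0 = x ∧ z k = y ∧ ∀ i < k, 0 < w (z i) (z (i + 1))

/-- The states reachable in `t` steps by the control system `u ↦ A u + e` with `e ∈ F`,
starting from `0`. -/
def reachable {V : Type*} [AddCommGroup V] [Module ℝ V] (A : V →ₗ[ℝ] V) (F : Submodule ℝ V) :
    ℕ → Submodule ℝ V
  | 0 => ⊥
  | t + 1 => (reachable A F t).map A ⊔ F

section Reachable

variable {V : Type*} [AddCommGroup V] [Module ℝ V] (A : V →ₗ[ℝ] V) (F : Submodule ℝ V)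

lemma reachable_le_succ (t : ℕ) : reachable A F t ≤ reachable A F (t + 1) := by
  induction t with
  | zero => exact bot_le
  | succ t ih => exact sup_le_sup_right (Submodule.map_mono ih) F

lemma reachable_eq_succ_or_le_finrank [FiniteDimensional ℝ V] (t : ℕ) :
    reachable A F t = reachable A F (t + 1) ∨
      t + 1 ≤ Module.finrank ℝ (reachable A F (t + 1)) := by
  refine or_iff_not_imp_left.2 fun h => ?_
  have hlt := Submodule.finrank_lt_finrank_of_lt ((reachable_le_succ A F t).lt_of_ne h)
  induction t with
  | zero => omega
  | succ t ih =>
    have hne : reachable A F t ≠ reachable A F (t + 1) := fun he =>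
      h (congrArg (fun R : Submodule ℝ V => R.map A ⊔ F) he)
    have := ih hne (Submodule.finrank_lt_finrank_of_lt ((reachable_le_succ A F t).lt_of_ne hne))
    omega

lemma reachable_eq_succ_of_finrank_le [FiniteDimensional ℝ V] {t : ℕ}
    (ht : Module.finrank ℝ V ≤ t) : reachable A F t = reachable A F (t + 1) := by
  refine (reachable_eq_succ_or_le_finrank A F t).resolve_right fun h => ?_
  have := Submodule.finrank_le (reachable A F (t + 1))
  omega

end Reachable

/-- A self-adjoint operator on a finite-dimensional space has an eigenvector orthogonal to any
given proper invariant subspace. -/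
lemma exists_eigenvector_orthogonal {V : Type*} [AddCommGroup V] [Module ℝ V]
    [FiniteDimensional ℝ V] (c : InnerProductSpace.Core ℝ V) (A : V →ₗ[ℝ] V)
    (hA : ∀ u v, c.inner (A u) v = c.inner u (A v)) (R : Submodule ℝ V)
    (hR : ∀ r ∈ R, A r ∈ R) (hne : R ≠ ⊤) :
    ∃ v : V, v ≠ 0 ∧ (∃ a : ℝ, A v = a • v) ∧ ∀ r ∈ R, c.inner r v = 0 := by
  let : NormedAddCommGroup V := c.toNormedAddCommGroup
  let : InnerProductSpace ℝ V := InnerProductSpace.ofCore c.toCore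
  have hS : A.IsSymmetric := hA
  have hinv : ∀ v ∈ Rᗮ, A v ∈ Rᗮ := fun v hv r hr => by
    rw [← hS r v]
    exact hv _ (hR r hr)
  have hnt : Nontrivial Rᗮ :=
    Submodule.nontrivial_iff_ne_bot.2 fun h => hne ((Submodule.orthogonal_eq_bot_iff).1 h)
  by_contra! hno
  refine not_subsingleton Rᗮ ?_
  refine (hS.restrict_invariant hinv).subsingleton_of_no_eigenvalue_finiteDimensional fun a => ?_
  refine (Submodule.eq_bot_iff _).2 fun v hv => ?_
  by_contra hv0
  have hAv : A v = a • (v : V) := congrArg Subtype.val (Module.End.mem_eigenspace_iff.1 hv)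
  obtain ⟨r, hr, hrv⟩ := hno v (by simpa using hv0) ⟨a, hAv⟩
  exact hrv (v.2 r hr)

section Weighted

variable {X : Type*} [Fintype X]

/-- The inner product of `ℓ²(X, μ)`. -/
@[reducible] noncomputable def weightedInner (μ : X → ℝ) (hμ : ∀ x, 0 < μ x) :
    InnerProductSpace.Core ℝ (X → ℝ) where
  inner u v := ∑ x, μ x * (u x * v x)
  conj_inner_symm u v := by simp [mul_comm]
  re_inner_nonneg u :=
    sum_nonneg fun x _ => mul_nonneg (hμ x).le (mul_self_nonneg (u x))
  add_left u v z := by simp [add_mul, mul_add, sum_add_distrib]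
  smul_left u v r := by
    simp only [Pi.smul_apply, smul_eq_mul, mul_sum, conj_trivial]
    exact sum_congr rfl fun x _ => by ring
  definite u h := by
    funext x
    have := (sum_eq_zero_iff_of_nonneg
      fun x _ => mul_nonneg (hμ x).le (mul_self_nonneg (u x))).1 h x (mem_univ x)
    simpa [(hμ x).ne'] using this

/-- The one-step evolution operator `1 + Δ` of the graph heat equation. -/
noncomputable def heatStep (w : X → X → ℝ) (μ : X → ℝ) : (X → ℝ) →ₗ[ℝ] (X → ℝ) where
  toFun u x := u x + graphLap w μ u x
  map_add' u v := by
    funext x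
    simp only [graphLap, Pi.add_apply, mul_sum, ← sum_add_distrib, add_add_add_comm]
    congr 1
    exact sum_congr rfl fun y _ => by ring
  map_smul' r u := by
    funext x
    simp only [graphLap, Pi.smul_apply, smul_eq_mul, RingHom.id_apply, mul_sum, mul_add]
    congr 1
    exact sum_congr rfl fun y _ => by ring

lemma heatStep_apply (w : X → X → ℝ) (μ : X → ℝ) (u : X → ℝ) (x : X) :
    heatStep w μ u x = u x + graphLap w μ u x := rfl

lemma heatStep_symmetric (w : X → X → ℝ) (μ : X → ℝ) (hw : ∀ x y, w x y = w y x)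
    (hμ : ∀ x, 0 < μ x) (u v : X → ℝ) :
    (weightedInner μ hμ).inner (heatStep w μ u) v =
      (weightedInner μ hμ).inner u (heatStep w μ v) := by
  have hmul : ∀ (u : X → ℝ) x, μ x * heatStep w μ u x =
      μ x * u x + ((∑ y, w x y * u y) - (∑ y, w x y) * u x) := fun u x => by
    have := (hμ x).ne'
    simp only [heatStep_apply, graphLap, mul_sub, sum_sub_distrib, sum_mul]
    field_simp
  have hswap : ∑ x, (∑ y, w x y * u y) * v x = ∑ x, (∑ y, w x y * v y) * u x := by
    simp only [sum_mul]
    rw [sum_comm]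
    exact sum_congr rfl fun x _ => sum_congr rfl fun y _ => by rw [hw]; ring
  change ∑ x, μ x * (heatStep w μ u x * v x) = ∑ x, μ x * (u x * heatStep w μ v x)
  have hl : ∀ x, μ x * (heatStep w μ u x * v x) =
      (μ x - ∑ y, w x y) * (u x * v x) + (∑ y, w x y * u y) * v x := fun x => by
    linear_combination v x * hmul u x
  have hr : ∀ x, μ x * (u x * heatStep w μ v x) =
      (μ x - ∑ y, w x y) * (u x * v x) + (∑ y, w x y * v y) * u x := fun x => by
    linear_combination u x * hmul v x
  simp only [hl, hr, sum_add_distrib, hswap]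

/-- The functions on `X` vanishing outside `B`. -/
def vanishingOff (B : Finset X) : Submodule ℝ (X → ℝ) where
  carrier := {u | ∀ x ∉ B, u x = 0}
  add_mem' hu hv x hx := by simp [hu x hx, hv x hx]
  zero_mem' _ _ := rfl
  smul_mem' r u hu x hx := by simp [hu x hx]

lemma heatSol_congr (w : X → X → ℝ) (μ : X → ℝ) {f f' : ℕ → X → ℝ} {T : ℕ}
    (h : ∀ t < T, f t = f' t) : heatSol w μ f T = heatSol w μ f' T := by
  induction T with
  | zero => rfl
  | succ T ih =>
    funext x
    simp only [heatSol, ih fun t ht => h t (ht.trans T.lt_succ_self), h T T.lt_succ_self]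

lemma exists_source_of_mem_reachable (w : X → X → ℝ) (μ : X → ℝ) (B : Finset X) {T : ℕ}
    {g : X → ℝ} (hg : g ∈ reachable (heatStep w μ) (vanishingOff B) T) :
    ∃ f : ℕ → X → ℝ, SuppOn T B f ∧ heatSol w μ f T = g := by
  induction T generalizing g with
  | zero => exact ⟨0, fun _ _ _ => rfl, ((Submodule.mem_bot ℝ).1 hg).symm⟩
  | succ T ih =>
    obtain ⟨_, ⟨r, hr, rfl⟩, e, he, rfl⟩ := Submodule.mem_sup.1 hg
    obtain ⟨f, hf, rfl⟩ := ih hr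
    refine ⟨Function.update f T e, fun t x htx => ?_, ?_⟩
    · rcases eq_or_ne t T with rfl | hne
      · rw [Function.update_self]
        exact he x (htx.resolve_left (by omega))
      · rw [Function.update_of_ne hne]
        exact hf t x (htx.imp_left fun h => by omega)
    · have := heatSol_congr w μ (f := Function.update f T e) (f' := f) (T := T)
        fun t ht => Function.update_of_ne ht.ne _ _
      funext x
      simp only [heatSol, this, Function.update_self, Pi.add_apply, heatStep_apply]

end Weighted

/-- Exact controllability of the graph heat equation: under the unique continuation
assumption on `B` and `T ≥ |X|`, every state `g` is reachable at time `T` by a source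
supported on `Z_T × B`. -/
theorem exact_controllability {X : Type*} [Fintype X] [Nonempty X]
    (w : X → X → ℝ) (μ : X → ℝ) (B : Finset X)
    (hw_symm : ∀ x y, w x y = w y x)
    (hw_nonneg : ∀ x y, 0 ≤ w x y)
    (hw_diag : ∀ x, w x x = 0)
    (hμ : ∀ x, 0 < μ x)
    (hconn : GraphConn w)
    (hbal : ∀ x, ∑ y, w x y ≤ μ x)
    (hUC : ∀ (v : X → ℝ) (lam : ℝ),
      (∀ x, -graphLap w μ v x = lam * v x) → (∀ b ∈ B, v b = 0) → v = 0)
    (T : ℕ) (hT : Fintype.card X ≤ T) :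
    ∀ g : X → ℝ, ∃ f : ℕ → X → ℝ, SuppOn T B f ∧ ∀ x, heatSol w μ f T x = g x := by
  classical
  intro g
  set R := reachable (heatStep w μ) (vanishingOff B) T with hRdef
  have hstep : (R.map (heatStep w μ)) ⊔ vanishingOff B = R :=
    (reachable_eq_succ_of_finrank_le (heatStep w μ) (vanishingOff B) (by simpa using hT)).symm
  have htop : R = ⊤ := by
    by_contra hne
    obtain ⟨v, hv0, ⟨a, hav⟩, horth⟩ := exists_eigenvector_orthogonal (weightedInner μ hμ)
      (heatStep w μ) (heatStep_symmetric w μ hw_symm hμ) R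
      (fun r hr => hstep.le (Submodule.mem_sup_left (Submodule.mem_map_of_mem hr))) hne
    refine hv0 (hUC v (1 - a) (fun x => ?_) fun b hb => ?_)
    · have : v x + graphLap w μ v x = a * v x := congrFun hav x
      linear_combination -this
    · have hmem : (Pi.single b 1 : X → ℝ) ∈ vanishingOff B := fun x hx =>
        Pi.single_eq_of_ne (fun h : x = b => hx (h ▸ hb)) _
      have h : ∑ x, μ x * ((Pi.single b 1 : X → ℝ) x * v x) = 0 :=
        horth _ (hstep.le (Submodule.mem_sup_right hmem))
      simpa [Pi.single_apply, (hμ b).ne'] using h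
  obtain ⟨f, hf, hfg⟩ := exists_source_of_mem_reachable w μ B
    (g := g) (T := T) (by rw [← hRdef, htop]; trivial)
  exact ⟨f, hf, congrFun hfg⟩
end

section
/- Adjoint of the source-to-solution map: let T ≥ 1, B ⊆ X, and let f, g : ℕ × X → ℝ be supported on Z_T × B. Define the time reversal (R g)(t,x) = g(T−1−t, x) for 0 ≤ t ≤ T−1 and (R g)(t,x) = 0 for t ≥ T. Then Σ_{t=0}^{T−1} Σ_{x∈B} μ(x) g(t,x) U^f(t,x) = Σ_{t=0}^{T−1} Σ_{x∈B} μ(x) U^{R g}(T−1−t, x) f(t,x). -/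
open Finset

/-- The time reversal on `Z_T`: `(R g)(t,x) = g(T−1−t, x)` for `0 ≤ t ≤ T−1`, and
`(R g)(t,x) = 0` for `t ≥ T`. -/
def timeRev {X : Type*} (T : ℕ) (g : ℕ → X → ℝ) : ℕ → X → ℝ :=
  fun t x => if t < T then g (T - 1 - t) x else 0

/-- The graph Laplacian is self-adjoint for the inner product weighted by `μ`. -/
theorem sum_mul_graphLap {X : Type*} [Fintype X] {w : X → X → ℝ} {μ : X → ℝ}
    (hw_symm : ∀ x y, w x y = w y x) (hμ : ∀ x, μ x ≠ 0) (a b : X → ℝ) :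
    ∑ x, μ x * a x * graphLap w μ b x = ∑ x, μ x * graphLap w μ a x * b x := by
  have hl : ∀ x, μ x * a x * graphLap w μ b x =
      ∑ y, w x y * a x * b y - ∑ y, w x y * a x * b x := fun x => by
    rw [graphLap, ← sum_sub_distrib, mul_assoc, mul_left_comm (a x), ← mul_assoc (μ x),
      mul_one_div_cancel (hμ x), one_mul, mul_sum]
    exact sum_congr rfl fun y _ => by ring
  have hr : ∀ x, μ x * graphLap w μ a x * b x =
      ∑ y, w x y * a y * b x - ∑ y, w x y * a x * b x := fun x => by
    rw [graphLap, ← sum_sub_distrib, ← mul_assoc (μ x), mul_one_div_cancel (hμ x), one_mul,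
      sum_mul]
    exact sum_congr rfl fun y _ => by ring
  simp only [hl, hr, sum_sub_distrib]
  congr 1
  rw [sum_comm]
  exact sum_congr rfl fun x _ => sum_congr rfl fun y _ => by rw [hw_symm]

/-- The discrete Duhamel reciprocity between two solutions of the heat equation. -/
theorem sum_source_mul_heatSol {X : Type*} [Fintype X] {w : X → X → ℝ} {μ : X → ℝ}
    (hw_symm : ∀ x y, w x y = w y x) (hμ : ∀ x, μ x ≠ 0) (f h : ℕ → X → ℝ) (n : ℕ) :
    ∑ t ∈ range n, ∑ x, μ x * h (n - 1 - t) x * heatSol w μ f t x =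
      ∑ t ∈ range n, ∑ x, μ x * heatSol w μ h (n - 1 - t) x * f t x := by
  have key := sum_range_sub
    (fun t => ∑ x, μ x * heatSol w μ h (n - t) x * heatSol w μ f t x) n
  rw [← sub_eq_zero, ← sum_sub_distrib, ← neg_eq_zero, ← sum_neg_distrib]
  refine (sum_congr rfl fun t ht => ?_).trans (key.trans (by simp [heatSol]))
  have h1 : n - t = (n - 1 - t) + 1 := by have := mem_range.1 ht; omega
  have h2 : n - (t + 1) = n - 1 - t := by omega
  have hself := sum_mul_graphLap hw_symm hμ (heatSol w μ h (n - 1 - t)) (heatSol w μ f t)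
  rw [h1, h2]
  simp only [heatSol, mul_add, add_mul, sum_add_distrib]
  linarith

/-- Adjoint of the source-to-solution map:
`Σ_{t=0}^{T−1} Σ_{x∈B} μ(x) g(t,x) U^f(t,x)
  = Σ_{t=0}^{T−1} Σ_{x∈B} μ(x) U^{Rg}(T−1−t, x) f(t,x)`. -/
theorem source_to_solution_adjoint {X : Type*} [Fintype X] [Nonempty X]
    (w : X → X → ℝ) (μ : X → ℝ)
    (hw_symm : ∀ x y, w x y = w y x)
    (hw_nonneg : ∀ x y, 0 ≤ w x y)
    (hw_diag : ∀ x, w x x = 0)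
    (hμ : ∀ x, 0 < μ x)
    (T : ℕ) (hT : 1 ≤ T) (B : Finset X)
    (f g : ℕ → X → ℝ) (hf : SuppOn T B f) (hg : SuppOn T B g) :
    ∑ t ∈ Finset.range T, ∑ x ∈ B, μ x * g t x * heatSol w μ f t x =
      ∑ t ∈ Finset.range T, ∑ x ∈ B,
        μ x * heatSol w μ (timeRev T g) (T - 1 - t) x * f t x := by
  have hμ0 : ∀ x, μ x ≠ 0 := fun x => (hμ x).ne'
  calc ∑ t ∈ range T, ∑ x ∈ B, μ x * g t x * heatSol w μ f t x
    _ = ∑ t ∈ range T, ∑ x, μ x * timeRev T g (T - 1 - t) x * heatSol w μ f t x := by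
      refine sum_congr rfl fun t ht => ?_
      have ht := mem_range.1 ht
      have hrev : timeRev T g (T - 1 - t) = g t := by
        funext x
        rw [timeRev, if_pos (by omega), show T - 1 - (T - 1 - t) = t by omega]
      rw [hrev]
      exact sum_subset (subset_univ B) fun x _ hx => by simp [hg t x (Or.inr hx)]
    _ = ∑ t ∈ range T, ∑ x, μ x * heatSol w μ (timeRev T g) (T - 1 - t) x * f t x :=
      sum_source_mul_heatSol hw_symm hμ0 f (timeRev T g) T
    _ = _ := sum_congr rfl fun t _ => Eq.symm <|
      sum_subset (subset_univ B) fun x _ hx => by simp [hf t x (Or.inr hx)]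
end
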